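/- Let T = (e₁,…,e₅) be a list of five 4-tuples of pairwise distinct indices in {1,…,8} covering every index. If the multiset of vertex degrees {deg_T(v) : v ∈ {1,…,8}} is not equal to the multiset {3,3,3,3,2,2,2,2}, then the cross-ratio degree of T is at most 2: there exists a nonzero polynomial q ∈ ℂ[x₁,…,x₅] such that N_T(a) ≤ 2 for every a ∈ (ℂ∖{0,1})⁵ with q(a) ≠ 0. -/

import Mathlib

open OnePoint

/-- Cross-ratio of four points of `ℙ¹(ℂ) = OnePoint ℂ`:
`CR(z₁,z₂,z₃,z₄) = ((z₃−z₁)(z₄−z₂))/((z₃−z₂)(z₄−z₁))` when all points are finite,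
extended to one point at infinity by omitting the two factors containing it. -/
noncomputable def CR : OnePoint ℂ → OnePoint ℂ → OnePoint ℂ → OnePoint ℂ → ℂ
  | Option.none,    Option.some z₂, Option.some z₃, Option.some z₄ => (z₄ - z₂) / (z₃ - z₂)
  | Option.some z₁, Option.none,    Option.some z₃, Option.some z₄ => (z₃ - z₁) / (z₄ - z₁)
  | Option.some z₁, Option.some z₂, Option.none,    Option.some z₄ => (z₄ - z₂) / (z₄ - z₁)
  | Option.some z₁, Option.some z₂, Option.some z₃, Option.none    => (z₃ - z₁) / (z₃ - z₂)
  | Option.some z₁, Option.some z₂, Option.some z₃, Option.some z₄ =>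
      ((z₃ - z₁) * (z₄ - z₂)) / ((z₃ - z₂) * (z₄ - z₁))
  | _, _, _, _ => 0

/-- The degree of a vertex `v` with respect to the datum `T`:
the number of indices `i` such that `v` occurs in the tuple `eᵢ = T i`. -/
def degT (T : Fin 5 → Fin 4 → Fin 8) (v : Fin 8) : ℕ :=
  (Finset.univ.filter fun i => ∃ j, T i j = v).card

theorem not_algebraicIndependent_localizationAway {σ τ : Type} [Fintype σ] [Fintype τ]
    (hcard : Fintype.card σ < Fintype.card τ) {D : MvPolynomial σ ℂ} (hD : D ≠ 0)
    (r : τ → Localization.Away D) : ¬ AlgebraicIndependent ℂ r := by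
  have hM : Submonoid.powers D ≤ nonZeroDivisors (MvPolynomial σ ℂ) :=
    powers_le_nonZeroDivisors_of_noZeroDivisors hD
  have : IsDomain (Localization.Away D) := IsLocalization.isDomain_localization hM
  have : FaithfulSMul (MvPolynomial σ ℂ) (Localization.Away D) :=
    (faithfulSMul_iff_algebraMap_injective _ _).2 (IsLocalization.injective _ hM)
  have : Algebra.IsAlgebraic (MvPolynomial σ ℂ) (Localization.Away D) :=
    IsLocalization.isAlgebraic _ (Submonoid.powers D)
  have hB := (IsTranscendenceBasis.mvPolynomial (ι := σ) (R := ℂ)).algebraMap_comp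
    (A := Localization.Away D)
  intro h
  have h1 := h.cardinalMk_le_trdeg
  rw [← hB.cardinalMk_eq_trdeg, Cardinal.mk_fintype, Cardinal.mk_fintype] at h1
  exact absurd (Nat.cast_le.1 h1) (by lia)

theorem exists_ne_zero_forall_finite {σ κ : Type} [Fintype σ] [Fintype κ]
    (hcard : Fintype.card σ ≤ Fintype.card κ) (N D : κ → MvPolynomial σ ℂ) :
    ∃ q : MvPolynomial κ ℂ, q ≠ 0 ∧ ∀ a : κ → ℂ, MvPolynomial.eval a q ≠ 0 →
      {z : σ → ℂ | ∀ k, MvPolynomial.eval z (D k) ≠ 0 ∧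
        MvPolynomial.eval z (N k) = a k * MvPolynomial.eval z (D k)}.Finite := by
  classical
  by_cases hD : ∏ k, D k = 0
  · refine ⟨1, one_ne_zero, fun a _ => ?_⟩
    convert Set.finite_empty
    ext z
    simp only [Set.mem_ofPred_eq, Set.mem_empty_iff_false, iff_false]
    intro h
    have : MvPolynomial.eval z (∏ k, D k) ≠ 0 := by
      rw [map_prod]
      exact Finset.prod_ne_zero_iff.2 fun k _ => (h k).1
    simp [hD] at this
  set P := ∏ k, D k with hP
  have hunit : ∀ k, IsUnit (algebraMap (MvPolynomial σ ℂ) (Localization.Away P) (D k)) := by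
    intro k
    exact isUnit_of_dvd_unit (map_dvd _ (Finset.dvd_prod_of_mem D (Finset.mem_univ k)))
      (IsLocalization.Away.algebraMap_isUnit P)
  let r : κ → Localization.Away P := fun k =>
    algebraMap _ _ (N k) * ((hunit k).unit⁻¹ : (Localization.Away P)ˣ)
  have hr : ∀ k, r k * algebraMap _ _ (D k) = algebraMap _ _ (N k) := by
    intro k
    have : (((hunit k).unit⁻¹ : (Localization.Away P)ˣ) : Localization.Away P) *
      algebraMap _ _ (D k) = 1 := (hunit k).val_inv_mul
    simp only [r, mul_assoc, this, mul_one]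
  have key : ∀ j : σ, ∃ F : Polynomial (MvPolynomial κ ℂ), F ≠ 0 ∧ ∀ (a : κ → ℂ) (z : σ → ℂ),
      (∀ k, MvPolynomial.eval z (D k) ≠ 0 ∧
        MvPolynomial.eval z (N k) = a k * MvPolynomial.eval z (D k)) →
      (F.map (MvPolynomial.eval a)).eval (z j) = 0 := by
    intro j
    let s : Option κ → Localization.Away P := fun o => o.elim
      (algebraMap (MvPolynomial σ ℂ) _ (MvPolynomial.X j)) r
    have hs : ¬ AlgebraicIndependent ℂ s :=
      not_algebraicIndependent_localizationAway (by simpa using Nat.lt_succ_of_le hcard) hD s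
    rw [algebraicIndependent_iff] at hs
    push Not at hs
    obtain ⟨F, hF0, hF⟩ := hs
    refine ⟨MvPolynomial.optionEquivLeft ℂ κ F, by simpa using hF, fun a z hz => ?_⟩
    rw [← MvPolynomial.optionEquivLeft_elim_eval]
    have hPz : IsUnit (MvPolynomial.aeval (R := ℂ) z P) := by
      rw [hP, map_prod, isUnit_iff_ne_zero]
      exact Finset.prod_ne_zero_iff.2 fun k _ => (hz k).1
    let φ : Localization.Away P →ₐ[ℂ] ℂ :=
      IsLocalization.liftAlgHom (M := Submonoid.powers P) (f := MvPolynomial.aeval (R := ℂ) z)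
        (by rintro ⟨_, n, rfl⟩; simpa using hPz.pow n)
    have hφ : ∀ f, φ (algebraMap _ _ f) = MvPolynomial.eval z f := by
      intro f
      simp [φ]
    have hs' : ∀ o : Option κ, φ (s o) = o.elim (z j) a := by
      rintro (_ | k)
      · simp [s, hφ]
      · have := congrArg φ (hr k)
        rw [map_mul, hφ, hφ, (hz k).2] at this
        exact mul_right_cancel₀ (hz k).1 this
    have := congrArg φ hF0
    rw [map_zero, MvPolynomial.comp_aeval_apply] at this
    simp only [hs', MvPolynomial.aeval_eq_eval] at this
    exact this
  choose F hF0 hF using key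
  refine ⟨∏ j, (F j).leadingCoeff, Finset.prod_ne_zero_iff.2 fun j _ => by simpa using hF0 j,
    fun a ha => ?_⟩
  rw [map_prod, Finset.prod_ne_zero_iff] at ha
  refine (Set.Finite.pi' (t := fun j => {y | ((F j).map (MvPolynomial.eval a)).IsRoot y})
    fun j => Polynomial.finite_setOfPred_isRoot ?_).subset fun z hz j => hF j a z hz
  intro h0
  apply ha j (Finset.mem_univ j)
  have := congrArg (fun f => Polynomial.coeff f (F j).natDegree) h0
  simpa using this

theorem infinite_setOf_forall_eval_ne_zero {κ : Type*} [Finite κ] (f : κ → Polynomial ℂ)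
    (hf : ∀ k, f k ≠ 0) : {x : ℂ | ∀ k, (f k).eval x ≠ 0}.Infinite := by
  have h : (⋃ k, {x : ℂ | (f k).IsRoot x}).Finite :=
    Set.finite_iUnion fun k => Polynomial.finite_setOfPred_isRoot (hf k)
  convert h.infinite_compl using 1
  ext x
  simp

theorem infinite_line_avoiding_points {κ : Type*} [Finite κ] (α β : κ → ℂ) (h0 : ∀ k, α k ≠ 0) :
    {s : ℂ | ∀ k, α k + β k * s ≠ 0}.Infinite := by
  have h := infinite_setOf_forall_eval_ne_zero
    (fun k => Polynomial.C (α k) + Polynomial.C (β k) * Polynomial.X) fun k hk => h0 k <| by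
      simpa using congrArg (Polynomial.eval 0) hk
  simpa only [Polynomial.eval_add, Polynomial.eval_mul, Polynomial.eval_C, Polynomial.eval_X]
    using h

/-- A conic through the origin and `(1, 0)` has infinitely many points avoiding finitely many lines
none of which passes through either of these two points. -/
theorem infinite_conic_avoiding_lines {κ : Type*} [Finite κ] {A B C D E : ℂ} (hAC : A + C = 0)
    (α β γ : κ → ℂ) (h0 : ∀ k, α k ≠ 0) (h1 : ∀ k, α k + β k ≠ 0) :
    {p : ℂ × ℂ | A * p.1 + B * p.2 + C * p.1 ^ 2 + D * p.1 * p.2 + E * p.2 ^ 2 = 0 ∧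
      ∀ k, α k + β k * p.1 + γ k * p.2 ≠ 0}.Infinite := by
  by_cases hA : A = 0
  · have hC : C = 0 := by simpa [hA] using hAC
    have h := infinite_line_avoiding_points α β h0
    refine (h.image (f := fun s => (s, (0 : ℂ))) fun x _ y _ hxy => (Prod.ext_iff.1 hxy).1).mono ?_
    rintro _ ⟨s, hs, rfl⟩
    refine ⟨by simp [hA, hC], fun k => by simpa using hs k⟩
  -- The line of slope `m` through the origin meets the conic again at `-ℓ / q • (1, m)`.
  let ℓ : Polynomial ℂ := Polynomial.C A + Polynomial.C B * Polynomial.X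
  let q : Polynomial ℂ :=
    Polynomial.C C + Polynomial.C D * Polynomial.X + Polynomial.C E * Polynomial.X ^ 2
  let f : Option (Option κ) → Polynomial ℂ := fun o => o.elim ℓ fun o => o.elim q fun k =>
    Polynomial.C (α k) * q - ℓ * (Polynomial.C (β k) + Polynomial.C (γ k) * Polynomial.X)
  have hC : C = -A := by linear_combination hAC
  have hf : ∀ o, f o ≠ 0 := by
    rintro (_ | _ | k) hk <;> replace hk := congrArg (Polynomial.eval 0) hk <;>
      simp only [f, ℓ, q, Option.elim] at hk <;> simp [hC] at hk
    · exact hA hk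
    · exact hA hk
    · exact mul_ne_zero hA (h1 k) (by linear_combination -hk)
  have h := infinite_setOf_forall_eval_ne_zero f hf
  let g : ℂ → ℂ × ℂ := fun m => (-ℓ.eval m / q.eval m, -ℓ.eval m / q.eval m * m)
  have hg : Set.InjOn g {x : ℂ | ∀ k, (f k).eval x ≠ 0} := by
    intro x hx y hy hxy
    obtain ⟨hxy1, hxy2⟩ := Prod.ext_iff.1 hxy
    simp only [g] at hxy1 hxy2
    rw [← hxy1] at hxy2
    exact mul_left_cancel₀
      (div_ne_zero (neg_ne_zero.2 (hx Option.none)) (hx (Option.some Option.none))) hxy2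
  refine (h.image hg).mono ?_
  rintro _ ⟨m, hm, rfl⟩
  have hq : q.eval m ≠ 0 := hm (Option.some Option.none)
  have hℓe : ℓ.eval m = A + B * m := by simp [ℓ]
  have hqe : q.eval m = C + D * m + E * m ^ 2 := by simp [q]
  constructor
  · have : -ℓ.eval m / q.eval m * q.eval m = -ℓ.eval m := div_mul_cancel₀ _ hq
    simp only [g]
    generalize -ℓ.eval m / q.eval m = t at *
    rw [hqe, hℓe] at this
    linear_combination t * this
  · intro k h
    have hk := hm (Option.some (Option.some k))
    have : -ℓ.eval m / q.eval m * q.eval m = -ℓ.eval m := div_mul_cancel₀ _ hq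
    simp only [g] at h
    generalize -ℓ.eval m / q.eval m = t at *
    simp only [f, Option.elim, Polynomial.eval_sub, Polynomial.eval_mul, Polynomial.eval_add,
      Polynomial.eval_C, Polynomial.eval_X] at hk
    apply hk
    linear_combination q.eval m * h - (β k + γ k * m) * this

/-- A finite set cut out, in a set `W` closed under affine combinations, by one equation that is
quadratic in affine functions and by finitely many affine inequations has at most two points. -/
theorem ncard_le_two_of_finite {V κ : Type*} [AddCommGroup V] [Module ℂ V] [Finite κ]
    {W : Set V} (hW : ∀ x ∈ W, ∀ y ∈ W, ∀ z ∈ W, ∀ s t : ℂ, x + s • (y - x) + t • (z - x) ∈ W)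
    (g : κ → V →ᵃ[ℂ] ℂ) (f₁ f₂ f₃ f₄ : V →ᵃ[ℂ] ℂ) (c : ℂ)
    (hfin : {x ∈ W | f₁ x * f₂ x = c * (f₃ x * f₄ x) ∧ ∀ k, g k x ≠ 0}.Finite) :
    {x ∈ W | f₁ x * f₂ x = c * (f₃ x * f₄ x) ∧ ∀ k, g k x ≠ 0}.ncard ≤ 2 := by
  by_contra! hcard
  obtain ⟨x, y, z, ⟨hxW, hxf, hxg⟩, ⟨hyW, hyf, hyg⟩, ⟨hzW, hzf, hzg⟩, hxy, hxz, hyz⟩ :=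
    (Set.two_lt_ncard_iff hfin).1 hcard
  have haff : ∀ (f : V →ᵃ[ℂ] ℂ) (s t : ℂ), f (x + s • (y - x) + t • (z - x)) =
      f x + (f y - f x) * s + (f z - f x) * t := by
    intro f s t
    have h : ∀ u v : V, f (u + v) = f.linear v + f u := fun u v => by
      rw [add_comm, ← vadd_eq_add, f.map_vadd, vadd_eq_add]
    have hy : f y = f.linear (y - x) + f x := by rw [← h]; simp
    have hz : f z = f.linear (z - x) + f x := by rw [← h]; simp
    rw [h, h, hy, hz, _root_.map_smul, _root_.map_smul, smul_eq_mul, smul_eq_mul]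
    ring
  have hmem : ∀ s t : ℂ, f₁ (x + s • (y - x) + t • (z - x)) * f₂ (x + s • (y - x) + t • (z - x)) =
      c * (f₃ (x + s • (y - x) + t • (z - x)) * f₄ (x + s • (y - x) + t • (z - x))) →
      (∀ k, g k x + (g k y - g k x) * s + (g k z - g k x) * t ≠ 0) →
      x + s • (y - x) + t • (z - x) ∈
        {x ∈ W | f₁ x * f₂ x = c * (f₃ x * f₄ x) ∧ ∀ k, g k x ≠ 0} := by
    intro s t h h'
    exact ⟨hW x hxW y hyW z hzW s t, h, fun k => by rw [haff]; exact h' k⟩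
  by_cases hcol : ∃ m : ℂ, z - x = m • (y - x)
  · obtain ⟨m, hm⟩ := hcol
    have hm0 : m ≠ 0 := by
      rintro rfl
      exact hxz (by simpa [sub_eq_zero, eq_comm] using hm)
    have hm1 : m ≠ 1 := by
      rintro rfl
      exact hyz (by simpa [eq_comm] using hm)
    have hz : z = x + m • (y - x) + (0 : ℂ) • (z - x) := by rw [← hm]; simp
    have hzf' := hzf
    rw [hz] at hzf'
    simp only [haff] at hzf'
    refine ((infinite_line_avoiding_points (fun k => g k x) (fun k => g k y - g k x) hxg).image
      (f := fun s => x + s • (y - x) + (0 : ℂ) • (z - x)) ?_).mono ?_ hfin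
    · intro s _ t _ hst
      simpa [sub_eq_zero, hxy.symm] using hst
    · rintro _ ⟨s, hs, rfl⟩
      refine hmem _ _ ?_ (by simpa using hs)
      simp only [haff]
      generalize f₁ x = a₁, f₂ x = a₂, f₃ x = a₃, f₄ x = a₄, f₁ y = b₁, f₂ y = b₂,
        f₃ y = b₃, f₄ y = b₄, f₁ z = c₁, f₂ z = c₂, f₃ z = c₃, f₄ z = c₄ at *
      have : m * (m - 1) * ((b₁ - a₁) * (b₂ - a₂) - c * ((b₃ - a₃) * (b₄ - a₄))) = 0 := by
        linear_combination hzf' - m * hyf - (1 - m) * hxf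
      have := (mul_eq_zero.1 this).resolve_left (mul_ne_zero hm0 (sub_ne_zero.2 hm1))
      linear_combination (1 - s) * hxf + s * hyf + s * (s - 1) * this
  · have hinj : Function.Injective fun p : ℂ × ℂ => x + p.1 • (y - x) + p.2 • (z - x) := by
      rintro ⟨s, t⟩ ⟨s', t'⟩ h
      have h' : (s - s') • (y - x) = (t' - t) • (z - x) := by
        simp only at h
        rw [sub_smul, sub_smul, sub_eq_sub_iff_add_eq_add]
        rw [add_assoc, add_assoc, add_right_inj] at h
        rw [h, add_comm]
      have ht : t' - t = 0 := by
        by_contra ht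
        refine hcol ⟨(t' - t)⁻¹ * (s - s'), ?_⟩
        rw [mul_smul, h', inv_smul_smul₀ ht]
      rw [ht, zero_smul, smul_eq_zero, or_iff_left (sub_ne_zero.2 hxy.symm)] at h'
      rw [sub_eq_zero.1 h', sub_eq_zero.1 ht]
    have h := infinite_conic_avoiding_lines
      (A := f₁ x * (f₂ y - f₂ x) + (f₁ y - f₁ x) * f₂ x -
        c * (f₃ x * (f₄ y - f₄ x) + (f₃ y - f₃ x) * f₄ x))
      (B := f₁ x * (f₂ z - f₂ x) + (f₁ z - f₁ x) * f₂ x -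
        c * (f₃ x * (f₄ z - f₄ x) + (f₃ z - f₃ x) * f₄ x))
      (C := (f₁ y - f₁ x) * (f₂ y - f₂ x) - c * ((f₃ y - f₃ x) * (f₄ y - f₄ x)))
      (D := (f₁ y - f₁ x) * (f₂ z - f₂ x) + (f₁ z - f₁ x) * (f₂ y - f₂ x) -
        c * ((f₃ y - f₃ x) * (f₄ z - f₄ x) + (f₃ z - f₃ x) * (f₄ y - f₄ x)))
      (E := (f₁ z - f₁ x) * (f₂ z - f₂ x) - c * ((f₃ z - f₃ x) * (f₄ z - f₄ x)))
      (by linear_combination hyf - hxf) (fun k => g k x) (fun k => g k y - g k x)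
      (fun k => g k z - g k x) hxg (fun k => by simpa using hyg k)
    refine (h.image hinj.injOn).mono ?_ hfin
    rintro _ ⟨⟨s, t⟩, ⟨h1, h2⟩, rfl⟩
    refine hmem _ _ ?_ h2
    simp only [haff]
    linear_combination h1 + hxf

theorem sum_card_filter_exists_eq (T : Fin 5 → Fin 4 → Fin 8) (hT : ∀ i, Function.Injective (T i))
    (E : Finset (Fin 5)) : ∑ v, (E.filter fun i => ∃ j, T i j = v).card = 4 * E.card := by
  have h : ∀ i ∈ E, (Finset.univ.filter fun v => ∃ j, T i j = v).card = 4 := by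
    intro i _
    have : (Finset.univ.filter fun v => ∃ j, T i j = v) = Finset.univ.image (T i) := by
      ext v
      simp
    rw [this, Finset.card_image_of_injective _ (hT i), Finset.card_fin]
  have := Finset.sum_card_bipartiteAbove_eq_sum_card_bipartiteBelow
    (s := Finset.univ) (t := E) (fun v i => ∃ j, T i j = v)
  simp only [Finset.bipartiteAbove, Finset.bipartiteBelow] at this
  rw [this, Finset.sum_congr rfl h, Finset.sum_const, smul_eq_mul, mul_comm]

theorem exists_forall_ne_of_card_le {α : Type*} (E : Finset α) (hE : E.Nonempty)
    (p : α → Prop) [DecidablePred p] (h : E.card ≤ (E.filter p).card + 1) :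
    ∃ f ∈ E, ∀ k ∈ E, k ≠ f → p k := by
  have h1 : (E.filter fun k => ¬ p k).card ≤ 1 := by
    have := Finset.card_filter_add_card_filter_not (s := E) p
    lia
  rcases (E.filter fun k => ¬ p k).eq_empty_or_nonempty with h0 | ⟨f, hf⟩
  · obtain ⟨f, hf⟩ := hE
    refine ⟨f, hf, fun k hk _ => ?_⟩
    by_contra hpk
    exact Finset.notMem_empty k (h0 ▸ Finset.mem_filter.2 ⟨hk, hpk⟩)
  · refine ⟨f, (Finset.mem_filter.1 hf).1, fun k hk hkf => ?_⟩
    by_contra hpk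
    exact hkf (Finset.card_le_one.1 h1 k (Finset.mem_filter.2 ⟨hk, hpk⟩) f hf)

theorem map_eq_of_forall_two_or_three (d : Fin 8 → ℕ) (hd : ∀ v, d v = 2 ∨ d v = 3)
    (hsum : ∑ v, d v = 20) :
    Finset.univ.val.map d = ({3, 3, 3, 3, 2, 2, 2, 2} : Multiset ℕ) := by
  have key : ∀ m : Multiset ℕ, (∀ x ∈ m, x = 2 ∨ x = 3) → ∃ a b : ℕ,
      m = Multiset.replicate a 3 + Multiset.replicate b 2 := by
    intro m
    induction m using Multiset.induction_on with
    | empty => exact fun _ => ⟨0, 0, rfl⟩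
    | cons x m ih =>
      intro h
      obtain ⟨a, b, hab⟩ := ih fun y hy => h y (Multiset.mem_cons_of_mem hy)
      rcases h x (Multiset.mem_cons_self x m) with rfl | rfl
      · exact ⟨a, b + 1, by rw [hab, Multiset.replicate_succ, Multiset.add_cons]⟩
      · exact ⟨a + 1, b, by rw [hab, Multiset.replicate_succ, Multiset.cons_add]⟩
  obtain ⟨a, b, hab⟩ := key (Finset.univ.val.map d) (by simpa only [Multiset.mem_map, Finset.mem_val, Finset.mem_univ, true_and,
    forall_exists_index, forall_apply_eq_imp_iff] using hd)
  have hcard := congrArg Multiset.card hab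
  have hs := congrArg Multiset.sum hab
  change ∑ v, d v = _ at hs
  simp at hcard hs
  rw [hab, show a = 4 by lia, show b = 4 by lia]
  rfl

theorem exists_vertex_of_degrees_ne (T : Fin 5 → Fin 4 → Fin 8)
    (hT : ∀ i, Function.Injective (T i)) (hcov : ∀ v : Fin 8, ∃ i j, T i j = v)
    (hdeg : Finset.univ.val.map (degT T) ≠ ({3, 3, 3, 3, 2, 2, 2, 2} : Multiset ℕ)) :
    (∃ w f, ∀ k, k ≠ f → ∃ j, T k j = w) ∨
    ∃ v w e f, v ≠ w ∧ f ≠ e ∧ (∃ j, T e j = v) ∧ (∀ k, k ≠ e → ∀ j, T k j ≠ v) ∧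
      ∀ k, k ≠ e → k ≠ f → ∃ j, T k j = w := by
  by_cases h4 : ∃ w, 4 ≤ degT T w
  · obtain ⟨w, hw⟩ := h4
    obtain ⟨f, -, hf⟩ := exists_forall_ne_of_card_le Finset.univ Finset.univ_nonempty
      (fun i => ∃ j, T i j = w) (by rw [degT] at hw; simp only [Finset.card_fin]; lia)
    exact Or.inl ⟨w, f, fun k => hf k (Finset.mem_univ k)⟩
  push Not at h4
  have hpos : ∀ v, 0 < degT T v := by
    intro v
    obtain ⟨i, j, h⟩ := hcov v
    exact Finset.card_pos.2 ⟨i, by simpa using ⟨j, h⟩⟩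
  have hsum : ∑ v, degT T v = 20 := sum_card_filter_exists_eq T hT Finset.univ
  obtain ⟨v, hv⟩ : ∃ v, degT T v = 1 := by
    by_contra! h1
    exact hdeg (map_eq_of_forall_two_or_three _
      (fun v => by have := h1 v; have := h4 v; have := hpos v; lia) hsum)
  obtain ⟨e, he⟩ := Finset.card_eq_one.1 hv
  simp only [Finset.ext_iff, Finset.mem_filter, Finset.mem_univ, true_and,
    Finset.mem_singleton] at he
  have hne : ∀ k, k ≠ e → ∀ j, T k j ≠ v := fun k hk j hj => hk ((he k).1 ⟨j, hj⟩)
  obtain ⟨w, hw, hw3⟩ : ∃ w ∈ Finset.univ.erase v,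
      2 < ((Finset.univ.erase e).filter fun i => ∃ j, T i j = w).card := by
    refine Finset.exists_lt_of_sum_lt ?_
    have h := sum_card_filter_exists_eq T hT (Finset.univ.erase e)
    rw [← Finset.add_sum_erase _ _ (Finset.mem_univ v), Finset.filter_false_of_mem] at h
    · rw [Finset.card_empty, zero_add] at h
      rw [h]
      simp
    · rintro k hk ⟨j, hj⟩
      exact hne k (Finset.ne_of_mem_erase hk) j hj
  obtain ⟨f, hf, hfw⟩ := exists_forall_ne_of_card_le (Finset.univ.erase e)
    (Finset.card_pos.1 (by simp)) (fun i => ∃ j, T i j = w) (by simp at hw3 ⊢; lia)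
  exact Or.inr ⟨v, w, e, f, (Finset.ne_of_mem_erase hw).symm, Finset.ne_of_mem_erase hf,
    (he e).2 rfl, hne, fun k hk => hfw k (Finset.mem_erase.2 ⟨hk, Finset.mem_univ k⟩)⟩

/-- The first homogeneous coordinate of a point of the projective line. -/
def homX : OnePoint ℂ → ℂ
  | Option.none => 1
  | Option.some z => z

/-- The second homogeneous coordinate of a point of the projective line. -/
def homY : OnePoint ℂ → ℂ
  | Option.none => 0
  | Option.some _ => 1

/-- The determinant of the homogeneous coordinates of two points. -/
def homDet (P Q : OnePoint ℂ) : ℂ := homX P * homY Q - homX Q * homY P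

theorem homDet_ne_zero {P Q : OnePoint ℂ} (h : P ≠ Q) : homDet P Q ≠ 0 := by
  rcases P with _ | x <;> rcases Q with _ | y
  · exact absurd rfl h
  · simp [homDet, homX, homY]
  · simp [homDet, homX, homY]
  · have : x ≠ y := fun hxy => h (congrArg _ hxy)
    simpa [homDet, homX, homY, sub_eq_zero] using this

theorem homDet_mul_eq_of_CR_eq {z₁ z₂ z₃ z₄ : OnePoint ℂ} {a : ℂ} (h12 : z₁ ≠ z₂) (h13 : z₁ ≠ z₃)
    (h14 : z₁ ≠ z₄) (h23 : z₂ ≠ z₃) (h24 : z₂ ≠ z₄) (h34 : z₃ ≠ z₄) (h : CR z₁ z₂ z₃ z₄ = a) :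
    homDet z₃ z₁ * homDet z₄ z₂ = a * (homDet z₃ z₂ * homDet z₄ z₁) := by
  have h32 := homDet_ne_zero h23.symm
  have h41 := homDet_ne_zero h14.symm
  subst h
  rcases z₁ with _ | z₁ <;> rcases z₂ with _ | z₂ <;> rcases z₃ with _ | z₃ <;>
    rcases z₄ with _ | z₄ <;> first
    | exact absurd rfl ‹_›
    | (simp [homDet, homX, homY] at h32 h41
       simp [homDet, homX, homY, CR]
       try field_simp
       try ring)

/-- The determinant of the homogeneous coordinates of the `i`-th and `j`-th of the points with
affine coordinates `z`, where the `w`-th point is moved to infinity. -/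
def bracket {A : Type*} [CommRing A] (w : Fin 8) (z : Fin 8 → A) (i j : Fin 8) : A :=
  (if i = w then 1 else z i) * (if j = w then 0 else 1) -
    (if j = w then 1 else z j) * (if i = w then 0 else 1)

theorem map_bracket {A B : Type*} [CommRing A] [CommRing B] (φ : A →+* B) (w : Fin 8)
    (z : Fin 8 → A) (i j : Fin 8) : φ (bracket w z i j) = bracket w (fun k => φ (z k)) i j := by
  simp only [bracket, map_sub, map_mul, apply_ite φ, map_one, map_zero]

theorem exists_affineMap_eq_bracket (w i j : Fin 8) :
    ∃ f : (Fin 8 → ℂ) →ᵃ[ℂ] ℂ, ∀ z, f z = bracket w z i j := by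
  let X : Fin 8 → (Fin 8 → ℂ) →ᵃ[ℂ] ℂ := fun i =>
    if i = w then AffineMap.const ℂ _ 1 else (LinearMap.proj i).toAffineMap
  refine ⟨(if j = w then (0 : ℂ) else 1) • X i - (if i = w then (0 : ℂ) else 1) • X j, fun z => ?_⟩
  have hX : ∀ i, X i z = if i = w then 1 else z i := by
    intro i
    by_cases h : i = w <;> simp [X, h]
  simp only [AffineMap.coe_sub, AffineMap.coe_smul, Pi.sub_apply, Pi.smul_apply, smul_eq_mul, hX,
    bracket]
  ring

theorem bracket_mul_eq_of_affine_combination {w : Fin 8} {e : Fin 4 → Fin 8}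
    (he : Function.Injective e) (hw : ∃ j, e j = w) {a s t : ℂ} {x y z v : Fin 8 → ℂ}
    (hx : bracket w x (e 2) (e 0) * bracket w x (e 3) (e 1) =
      a * (bracket w x (e 2) (e 1) * bracket w x (e 3) (e 0)))
    (hy : bracket w y (e 2) (e 0) * bracket w y (e 3) (e 1) =
      a * (bracket w y (e 2) (e 1) * bracket w y (e 3) (e 0)))
    (hz : bracket w z (e 2) (e 0) * bracket w z (e 3) (e 1) =
      a * (bracket w z (e 2) (e 1) * bracket w z (e 3) (e 0)))
    (hv : v = x + s • (y - x) + t • (z - x)) :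
    bracket w v (e 2) (e 0) * bracket w v (e 3) (e 1) =
      a * (bracket w v (e 2) (e 1) * bracket w v (e 3) (e 0)) := by
  obtain ⟨j, rfl⟩ := hw
  subst hv
  fin_cases j <;> simp [bracket, he.eq_iff] at hx hy hz ⊢ <;>
    linear_combination (1 - s - t) * hx + s * hy + t * hz

theorem eq_of_bracket_mul_eq {w v : Fin 8} (hvw : v ≠ w) {e : Fin 4 → Fin 8}
    (he : Function.Injective e) (hv : ∃ j, e j = v) {a : ℂ} {x y : Fin 8 → ℂ}
    (hxy : ∀ i, i ≠ v → x i = y i)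
    (hne : ∀ i j, i ≠ j → bracket w x i j ≠ 0)
    (hx : bracket w x (e 2) (e 0) * bracket w x (e 3) (e 1) =
      a * (bracket w x (e 2) (e 1) * bracket w x (e 3) (e 0)))
    (hy : bracket w y (e 2) (e 0) * bracket w y (e 3) (e 1) =
      a * (bracket w y (e 2) (e 1) * bracket w y (e 3) (e 0))) :
    x v = y v := by
  obtain ⟨j, rfl⟩ := hv
  have h20 := hne (e 2) (e 0) (he.ne (by decide))
  have h21 := hne (e 2) (e 1) (he.ne (by decide))
  have h30 := hne (e 3) (e 0) (he.ne (by decide))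
  have h31 := hne (e 3) (e 1) (he.ne (by decide))
  have h32 := hne (e 3) (e 2) (he.ne (by decide))
  have h10 := hne (e 1) (e 0) (he.ne (by decide))
  by_contra hne'
  have hsub := sub_ne_zero.2 hne'
  have hX : ∀ i : Fin 4, i ≠ j →
      (if e i = w then 1 else y (e i)) = if e i = w then 1 else x (e i) := by
    intro i hi
    rw [hxy (e i) (he.ne hi)]
  fin_cases j <;> simp only [bracket] at hx hy h20 h21 h30 h31 h32 h10
  · rw [hX 1 (by decide), hX 2 (by decide), hX 3 (by decide)] at hy
    refine mul_ne_zero hsub (mul_ne_zero h31 h32) ?_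
    simp only [Fin.zero_eta] at hvw hx hy ⊢
    simp only [if_neg hvw] at hx hy ⊢
    linear_combination ((if e 3 = w then 1 else x (e 3)) * (hy - hx) -
      (if e 3 = w then 0 else 1) * (x (e 0) * hy - y (e 0) * hx))
  · rw [hX 0 (by decide), hX 2 (by decide), hX 3 (by decide)] at hy
    refine mul_ne_zero hsub (mul_ne_zero h20 h32) ?_
    simp only [Fin.mk_one] at hvw hx hy ⊢
    simp only [if_neg hvw] at hx hy ⊢
    linear_combination -((if e 2 = w then 1 else x (e 2)) * (hy - hx) -
      (if e 2 = w then 0 else 1) * (x (e 1) * hy - y (e 1) * hx))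
  · rw [hX 0 (by decide), hX 1 (by decide), hX 3 (by decide)] at hy
    refine mul_ne_zero hsub (mul_ne_zero h31 h10) ?_
    simp only [Fin.reduceFinMk] at hvw hx hy ⊢
    simp only [if_neg hvw] at hx hy ⊢
    linear_combination -((if e 1 = w then 1 else x (e 1)) * (hy - hx) -
      (if e 1 = w then 0 else 1) * (x (e 2) * hy - y (e 2) * hx))
  · rw [hX 0 (by decide), hX 1 (by decide), hX 2 (by decide)] at hy
    refine mul_ne_zero hsub (mul_ne_zero h20 h10) ?_
    simp only [Fin.reduceFinMk] at hvw hx hy ⊢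
    simp only [if_neg hvw] at hx hy ⊢
    linear_combination ((if e 0 = w then 1 else x (e 0)) * (hy - hx) -
      (if e 0 = w then 0 else 1) * (x (e 3) * hy - y (e 3) * hx))

/-- The affine coordinates of the configurations of the points in `R` satisfying the cross-ratio
conditions in `E`, normalized so that `w`, `u`, `u'` are placed at `∞`, `0`, `1`. -/
def affineSolutions (T : Fin 5 → Fin 4 → Fin 8) (R : Finset (Fin 8)) (E : Finset (Fin 5))
    (w u u' : Fin 8) (a : Fin 5 → ℂ) : Set (Fin 8 → ℂ) :=
  {z | (∀ i, i ∉ R ∨ i = w → z i = 0) ∧ z u = 0 ∧ z u' = 1 ∧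
    (∀ i ∈ R, ∀ j ∈ R, i ≠ j → bracket w z i j ≠ 0) ∧
    ∀ k ∈ E, bracket w z (T k 2) (T k 0) * bracket w z (T k 3) (T k 1) =
      a k * (bracket w z (T k 2) (T k 1) * bracket w z (T k 3) (T k 0))}

theorem exists_ne_zero_finite_affineSolutions {T : Fin 5 → Fin 4 → Fin 8}
    (hT : ∀ i, Function.Injective (T i)) {R : Finset (Fin 8)} {E : Finset (Fin 5)}
    {w u u' : Fin 8} (hw : w ∈ R) (hu : u ∈ R) (hu' : u' ∈ R) (huw : u ≠ w) (hu'w : u' ≠ w)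
    (huu' : u ≠ u') (hE : ∀ k ∈ E, ∀ j, T k j ∈ R) (hcard : R.card ≤ E.card + 3) :
    ∃ q : MvPolynomial (Fin 5) ℂ, q ≠ 0 ∧ ∀ a : Fin 5 → ℂ, MvPolynomial.eval a q ≠ 0 →
      (affineSolutions T R E w u u' a).Finite := by
  let V : Finset (Fin 8) := ((R.erase w).erase u).erase u'
  have hV : V.card + 3 = R.card := by
    have h1 := Finset.card_erase_add_one hw
    have h2 := Finset.card_erase_add_one (Finset.mem_erase.2 ⟨huw, hu⟩)
    have h3 := Finset.card_erase_add_one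
      (Finset.mem_erase.2 ⟨huu'.symm, Finset.mem_erase.2 ⟨hu'w, hu'⟩⟩)
    simp only [V]
    lia
  let Z : Fin 8 → MvPolynomial V ℂ := fun i =>
    if h : i ∈ V then MvPolynomial.X ⟨i, h⟩ else if i = u' then 1 else 0
  obtain ⟨q, hq0, hq⟩ := exists_ne_zero_forall_finite (σ := V) (κ := E)
    (by simp only [Fintype.card_coe]; lia)
    (fun k => bracket w Z (T k 2) (T k 0) * bracket w Z (T k 3) (T k 1))
    (fun k => bracket w Z (T k 2) (T k 1) * bracket w Z (T k 3) (T k 0))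
  refine ⟨MvPolynomial.rename Subtype.val q,
    (MvPolynomial.rename_injective _ Subtype.val_injective).ne_iff' (map_zero _) |>.2 hq0,
    fun a ha => ?_⟩
  rw [MvPolynomial.eval_rename] at ha
  refine ((hq _ ha).image fun y i => MvPolynomial.eval y (Z i)).subset ?_
  rintro z ⟨h0, hzu, hzu', hne, heq⟩
  have hz : (fun i => MvPolynomial.eval (fun v : V => z v) (Z i)) = z := by
    funext i
    by_cases hi : i ∈ V
    · simp [Z, hi]
    by_cases hiu' : i = u'
    · simp only [Z, dif_neg hi, if_pos hiu', map_one]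
      rw [hiu', hzu']
    simp only [Z, hi, hiu', dite_false, if_false, map_zero]
    by_cases hiu : i = u
    · rw [hiu, hzu]
    refine (h0 i ?_).symm
    by_contra! h
    exact hi (by simp [V, h.1, h.2, hiu, hiu'])
  refine ⟨fun v => z v, fun k => ?_, hz⟩
  simp only [map_mul, map_bracket, hz]
  refine ⟨mul_ne_zero ?_ ?_, heq k k.2⟩ <;>
    exact hne _ (hE k k.2 _) _ (hE k k.2 _) ((hT k).ne (by decide))

theorem ncard_affineSolutions_le_two {T : Fin 5 → Fin 4 → Fin 8}
    (hT : ∀ i, Function.Injective (T i)) {R : Finset (Fin 8)} {E : Finset (Fin 5)}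
    {w u u' : Fin 8} {f : Fin 5} (hf : f ∈ E) (hw : ∀ k ∈ E, k ≠ f → ∃ j, T k j = w)
    {a : Fin 5 → ℂ} (hfin : (affineSolutions T R E w u u' a).Finite) :
    (affineSolutions T R E w u u' a).ncard ≤ 2 := by
  choose g hg using exists_affineMap_eq_bracket w
  let W : Set (Fin 8 → ℂ) := {z | (∀ i, i ∉ R ∨ i = w → z i = 0) ∧ z u = 0 ∧ z u' = 1 ∧
    ∀ k ∈ E, k ≠ f → bracket w z (T k 2) (T k 0) * bracket w z (T k 3) (T k 1) =
      a k * (bracket w z (T k 2) (T k 1) * bracket w z (T k 3) (T k 0))}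
  have hW : ∀ x ∈ W, ∀ y ∈ W, ∀ z ∈ W, ∀ s t : ℂ, x + s • (y - x) + t • (z - x) ∈ W := by
    rintro x ⟨hx1, hx2, hx3, hx⟩ y ⟨hy1, hy2, hy3, hy⟩ z ⟨hz1, hz2, hz3, hz⟩ s t
    refine ⟨fun i hi => ?_, ?_, ?_, fun k hk hkf => ?_⟩
    · simp [hx1 i hi, hy1 i hi, hz1 i hi]
    · simp [hx2, hy2, hz2]
    · simp [hx3, hy3, hz3]
    · exact bracket_mul_eq_of_affine_combination (hT k) (hw k hk hkf) (hx k hk hkf) (hy k hk hkf)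
        (hz k hk hkf) rfl
  have hS : affineSolutions T R E w u u' a = {x ∈ W |
      g (T f 2) (T f 0) x * g (T f 3) (T f 1) x =
        a f * (g (T f 2) (T f 1) x * g (T f 3) (T f 0) x) ∧
      ∀ p : {p : Fin 8 × Fin 8 // p.1 ∈ R ∧ p.2 ∈ R ∧ p.1 ≠ p.2}, g p.1.1 p.1.2 x ≠ 0} := by
    ext x
    simp only [hg, affineSolutions, W, Set.mem_ofPred_eq]
    constructor
    · rintro ⟨h1, h2, h3, h4, h5⟩
      exact ⟨⟨h1, h2, h3, fun k hk _ => h5 k hk⟩, h5 f hf,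
        fun p => h4 _ p.2.1 _ p.2.2.1 p.2.2.2⟩
    · rintro ⟨⟨h1, h2, h3, h4⟩, h5, h6⟩
      refine ⟨h1, h2, h3, fun i hi j hj hij => h6 ⟨(i, j), hi, hj, hij⟩, fun k hk => ?_⟩
      by_cases hkf : k = f
      · exact hkf ▸ h5
      · exact h4 k hk hkf
  rw [hS] at hfin ⊢
  exact ncard_le_two_of_finite hW _ _ _ _ _ _ hfin

/-- The affine coordinates of the points `p` after the projective transformation that moves `p w`,
`p u`, `p u'` to `∞`, `0`, `1`. -/
noncomputable def affineCoord (w u u' : Fin 8) (p : Fin 8 → OnePoint ℂ) (i : Fin 8) : ℂ :=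
  if i = w then 0 else
    homDet (p i) (p u) * homDet (p u') (p w) / (homDet (p i) (p w) * homDet (p u') (p u))

theorem exists_bracket_affineCoord_eq {w u u' : Fin 8} (huw : u ≠ w) (hu'w : u' ≠ w)
    (huu' : u ≠ u') {p : Fin 8 → OnePoint ℂ} (hp : Function.Injective p) :
    ∃ (c : ℂ) (l : Fin 8 → ℂ), c ≠ 0 ∧ (∀ i, l i ≠ 0) ∧ ∀ i j,
      bracket w (affineCoord w u u' p) i j = c * l i * l j * homDet (p i) (p j) := by
  have h1 := homDet_ne_zero (hp.ne huw)
  have h2 := homDet_ne_zero (hp.ne hu'w)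
  have h3 := homDet_ne_zero (hp.ne huu'.symm)
  have hw : ∀ i, i ≠ w → homDet (p i) (p w) ≠ 0 := fun i hi => homDet_ne_zero (hp.ne hi)
  have hsymm : ∀ i j, homDet (p i) (p j) = -homDet (p j) (p i) := fun i j => by
    simp only [homDet]; ring
  have hself : ∀ i, homDet (p i) (p i) = 0 := fun i => by simp only [homDet]; ring
  set c := homDet (p u) (p w) * homDet (p u') (p w) / homDet (p u') (p u) with hc
  have hc0 : c ≠ 0 := div_ne_zero (mul_ne_zero h1 h2) h3
  refine ⟨c, fun i => if i = w then -c⁻¹ else (homDet (p i) (p w))⁻¹, hc0, fun i => ?_,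
    fun i j => ?_⟩
  · dsimp only
    split_ifs with hi
    · exact neg_ne_zero.2 (inv_ne_zero hc0)
    · exact inv_ne_zero (hw i hi)
  by_cases hi : i = w <;> by_cases hj : j = w
  · simp [bracket, hi, hj, hself]
  · have := hw j hj
    simp only [bracket, affineCoord, hi, hj, if_true, if_false]
    rw [hsymm w j]
    field_simp
    ring
  · have := hw i hi
    simp only [bracket, affineCoord, hi, hj, if_true, if_false]
    field_simp
    ring
  · have hwi := hw i hi
    have hwj := hw j hj
    simp only [bracket, affineCoord, hi, hj, if_false]
    rw [hc]
    field_simp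
    simp only [homDet]
    ring

theorem affineCoord_mem_affineSolutions {T : Fin 5 → Fin 4 → Fin 8}
    (hT : ∀ i, Function.Injective (T i)) {w u u' : Fin 8} (huw : u ≠ w) (hu'w : u' ≠ w)
    (huu' : u ≠ u') {p : Fin 8 → OnePoint ℂ} (hp : Function.Injective p) {a : Fin 5 → ℂ}
    (h : ∀ i, CR (p (T i 0)) (p (T i 1)) (p (T i 2)) (p (T i 3)) = a i) :
    affineCoord w u u' p ∈ affineSolutions T Finset.univ Finset.univ w u u' a := by
  obtain ⟨c, l, hc, hl, hb⟩ := exists_bracket_affineCoord_eq huw hu'w huu' hp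
  refine ⟨fun i hi => ?_, ?_, ?_, fun i _ j _ hij => ?_, fun k _ => ?_⟩
  · simp [affineCoord, hi.resolve_left (by simp)]
  · simp only [affineCoord, if_neg huw, homDet]
    ring
  · rw [affineCoord, if_neg hu'w, mul_comm]
    exact div_self (mul_ne_zero (homDet_ne_zero (hp.ne hu'w)) (homDet_ne_zero (hp.ne huu'.symm)))
  · rw [hb]
    exact mul_ne_zero (mul_ne_zero (mul_ne_zero hc (hl i)) (hl j)) (homDet_ne_zero (hp.ne hij))
  · have hd : ∀ i j : Fin 4, i ≠ j → p (T k i) ≠ p (T k j) := fun i j hij =>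
      hp.ne ((hT k).ne hij)
    have := homDet_mul_eq_of_CR_eq (hd 0 1 (by decide)) (hd 0 2 (by decide)) (hd 0 3 (by decide))
      (hd 1 2 (by decide)) (hd 1 3 (by decide)) (hd 2 3 (by decide)) (h k)
    simp only [hb]
    linear_combination c ^ 2 * l (T k 0) * l (T k 1) * l (T k 2) * l (T k 3) * this

theorem affineCoord_injOn {w u u' : Fin 8} (huw : u ≠ w) (hu'w : u' ≠ w) (huu' : u ≠ u') :
    Set.InjOn (affineCoord w u u') {p | Function.Injective p ∧ p 0 = ∞ ∧
      p 1 = ((0 : ℂ) : OnePoint ℂ) ∧ p 2 = ((1 : ℂ) : OnePoint ℂ)} := by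
  have key : ∀ p : Fin 8 → OnePoint ℂ, Function.Injective p ∧ p 0 = ∞ ∧
      p 1 = ((0 : ℂ) : OnePoint ℂ) ∧ p 2 = ((1 : ℂ) : OnePoint ℂ) → ∀ i, i ≠ 0 →
      p i = ((bracket w (affineCoord w u u' p) i 1 * bracket w (affineCoord w u u' p) 2 0 /
        (bracket w (affineCoord w u u' p) i 0 * bracket w (affineCoord w u u' p) 2 1) : ℂ) :
        OnePoint ℂ) := by
    rintro p ⟨hp, h0, h1, h2⟩ i hi
    obtain ⟨c, l, hc, hl, hb⟩ := exists_bracket_affineCoord_eq huw hu'w huu' hp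
    obtain ⟨x, hx⟩ := OnePoint.ne_infty_iff_exists.1 (h0 ▸ hp.ne hi)
    have hli := hl i
    have hl0 := hl 0
    have hl1 := hl 1
    have hl2 := hl 2
    have e1 : homDet (p i) (p 1) = x := by rw [← hx, h1]; simp [homDet, homX, homY]
    have e2 : homDet (p i) (p 0) = -1 := by
      rw [← hx, h0]; simp [homDet, homX, homY]
    have e3 : homDet (p 2) (p 0) = -1 := by
      rw [h2, h0]; simp [homDet, homX, homY]
    have e4 : homDet (p 2) (p 1) = 1 := by rw [h2, h1]; simp [homDet, homX, homY]
    rw [hb, hb, hb, hb, e1, e2, e3, e4, ← hx]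
    congr 1
    field_simp
  intro p hp p' hp' h
  funext i
  by_cases hi : i = 0
  · rw [hi, hp.2.1, hp'.2.1]
  · rw [key p hp i hi, key p' hp' i hi, h]

theorem update_mem_affineSolutions {T : Fin 5 → Fin 4 → Fin 8} {w u u' v : Fin 8} {e : Fin 5}
    (huv : u ≠ v) (hu'v : u' ≠ v) (hv : ∀ k, k ≠ e → ∀ j, T k j ≠ v) {a : Fin 5 → ℂ}
    {z : Fin 8 → ℂ} (hz : z ∈ affineSolutions T Finset.univ Finset.univ w u u' a) :
    Function.update z v 0 ∈
      affineSolutions T (Finset.univ.erase v) (Finset.univ.erase e) w u u' a := by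
  obtain ⟨h1, h2, h3, h4, h5⟩ := hz
  have hb : ∀ i j, i ≠ v → j ≠ v → bracket w (Function.update z v 0) i j = bracket w z i j := by
    intro i j hi hj
    simp only [bracket, Function.update_of_ne hi, Function.update_of_ne hj]
  refine ⟨fun i hi => ?_, by rwa [Function.update_of_ne huv], by rwa [Function.update_of_ne hu'v],
    fun i hi j hj hij => ?_, fun k hk => ?_⟩
  · by_cases hiv : i = v
    · simp [hiv]
    · rw [Function.update_of_ne hiv]
      exact h1 i (Or.inr (hi.resolve_left (by simpa using hiv)))
  · rw [hb i j (Finset.ne_of_mem_erase hi) (Finset.ne_of_mem_erase hj)]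
    exact h4 i (Finset.mem_univ i) j (Finset.mem_univ j) hij
  · have hk' := hv k (Finset.ne_of_mem_erase hk)
    rw [hb _ _ (hk' _) (hk' _), hb _ _ (hk' _) (hk' _), hb _ _ (hk' _) (hk' _),
      hb _ _ (hk' _) (hk' _)]
    exact h5 k (Finset.mem_univ k)

theorem update_injOn_affineSolutions {T : Fin 5 → Fin 4 → Fin 8}
    (hT : ∀ i, Function.Injective (T i)) {w u u' v : Fin 8} {e : Fin 5} (hvw : v ≠ w)
    (hv : ∃ j, T e j = v) (a : Fin 5 → ℂ) :
    Set.InjOn (fun z => Function.update z v (0 : ℂ))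
      (affineSolutions T Finset.univ Finset.univ w u u' a) := by
  rintro x ⟨-, -, -, hx, hxe⟩ y ⟨-, -, -, -, hye⟩ hxy
  have hoff : ∀ i, i ≠ v → x i = y i := by
    intro i hi
    simpa [Function.update_of_ne hi] using congrFun hxy i
  funext i
  by_cases hi : i = v
  · rw [hi]
    exact eq_of_bracket_mul_eq hvw (hT e) hv hoff
      (fun i j hij => hx i (Finset.mem_univ i) j (Finset.mem_univ j) hij)
      (hxe e (Finset.mem_univ e)) (hye e (Finset.mem_univ e))
  · exact hoff i hi

theorem exists_ne_zero_affineSolutions_univ {T : Fin 5 → Fin 4 → Fin 8}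
    (hT : ∀ i, Function.Injective (T i)) (hcov : ∀ v : Fin 8, ∃ i j, T i j = v)
    (hdeg : Finset.univ.val.map (degT T) ≠ ({3, 3, 3, 3, 2, 2, 2, 2} : Multiset ℕ)) :
    ∃ w u u', u ≠ w ∧ u' ≠ w ∧ u ≠ u' ∧ ∃ q : MvPolynomial (Fin 5) ℂ, q ≠ 0 ∧
      ∀ a : Fin 5 → ℂ, MvPolynomial.eval a q ≠ 0 →
        (affineSolutions T Finset.univ Finset.univ w u u' a).Finite ∧
        (affineSolutions T Finset.univ Finset.univ w u u' a).ncard ≤ 2 := by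
  rcases exists_vertex_of_degrees_ne T hT hcov hdeg with
    ⟨w, f, hf⟩ | ⟨v, w, e, f, hvw, hfe, hv, hne, hf⟩
  · obtain ⟨u, hu, u', hu', huu'⟩ := Finset.one_lt_card.1
      (show 1 < ((Finset.univ : Finset (Fin 8)).erase w).card by simp)
    have huw := Finset.ne_of_mem_erase hu
    have hu'w := Finset.ne_of_mem_erase hu'
    obtain ⟨q, hq0, hq⟩ := exists_ne_zero_finite_affineSolutions hT (E := Finset.univ)
      (Finset.mem_univ w) (Finset.mem_univ u) (Finset.mem_univ u') huw hu'w huu' (by simp) (by simp)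
    refine ⟨w, u, u', huw, hu'w, huu', q, hq0, fun a ha => ⟨hq a ha, ?_⟩⟩
    exact ncard_affineSolutions_le_two hT (Finset.mem_univ f) (fun k _ => hf k) (hq a ha)
  · obtain ⟨u, hu, u', hu', huu'⟩ := Finset.one_lt_card.1
      (show 1 < (((Finset.univ : Finset (Fin 8)).erase v).erase w).card by
        rw [Finset.card_erase_of_mem (by simpa using hvw.symm)]; simp)
    simp only [Finset.mem_erase, Finset.mem_univ, and_true] at hu hu'
    obtain ⟨q, hq0, hq⟩ := exists_ne_zero_finite_affineSolutions hT (R := Finset.univ.erase v)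
      (E := Finset.univ.erase e) (w := w) (u := u) (u' := u') (by simpa using hvw.symm)
      (by simpa using hu.2) (by simpa using hu'.2) hu.1 hu'.1 huu'
      (fun k hk j => by simpa using hne k (Finset.ne_of_mem_erase hk) j) (by simp)
    refine ⟨w, u, u', hu.1, hu'.1, huu', q, hq0, fun a ha => ?_⟩
    have hmaps : Set.MapsTo (fun z => Function.update z v (0 : ℂ))
        (affineSolutions T Finset.univ Finset.univ w u u' a)
        (affineSolutions T (Finset.univ.erase v) (Finset.univ.erase e) w u u' a) :=
      fun z hz => update_mem_affineSolutions hu.2 hu'.2 hne hz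
    have hinj := update_injOn_affineSolutions (u := u) (u' := u') hT hvw hv a
    exact ⟨Set.Finite.of_injOn hmaps hinj (hq a ha),
      (Set.ncard_le_ncard_of_injOn _ hmaps hinj (hq a ha)).trans
        (ncard_affineSolutions_le_two hT (f := f) (by simpa using hfe)
          (fun k hk => hf k (Finset.ne_of_mem_erase hk)) (hq a ha))⟩

/-- If the multiset of vertex degrees of the datum is not `{3,3,3,3,2,2,2,2}`, then
the cross-ratio degree is at most 2. -/
theorem crossRatioDegree_le_two_of_degrees_ne
    (T : Fin 5 → Fin 4 → Fin 8)
    (hT : ∀ i, Function.Injective (T i))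
    (hcov : ∀ v : Fin 8, ∃ i j, T i j = v)
    (hdeg : Finset.univ.val.map (degT T) ≠ ({3, 3, 3, 3, 2, 2, 2, 2} : Multiset ℕ)) :
    ∃ q : MvPolynomial (Fin 5) ℂ, q ≠ 0 ∧
      ∀ a : Fin 5 → ℂ, (∀ i, a i ≠ 0 ∧ a i ≠ 1) → MvPolynomial.eval a q ≠ 0 →
        let S : Set (Fin 8 → OnePoint ℂ) :=
          {p | Function.Injective p ∧ p 0 = ∞ ∧ p 1 = ((0 : ℂ) : OnePoint ℂ) ∧
            p 2 = ((1 : ℂ) : OnePoint ℂ) ∧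
            ∀ i, CR (p (T i 0)) (p (T i 1)) (p (T i 2)) (p (T i 3)) = a i}
        S.Finite ∧ S.ncard ≤ 2 := by
  obtain ⟨w, u, u', huw, hu'w, huu', q, hq0, hq⟩ := exists_ne_zero_affineSolutions_univ hT hcov hdeg
  refine ⟨q, hq0, fun a _ ha => ?_⟩
  intro S
  have hmaps : Set.MapsTo (affineCoord w u u') S
      (affineSolutions T Finset.univ Finset.univ w u u' a) :=
    fun p hp => affineCoord_mem_affineSolutions hT huw hu'w huu' hp.1 hp.2.2.2.2
  have hinj : Set.InjOn (affineCoord w u u') S := by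
    refine (affineCoord_injOn huw hu'w huu').mono ?_
    rintro p ⟨hp, h0, h1, h2, -⟩
    exact ⟨hp, h0, h1, h2⟩
  exact ⟨Set.Finite.of_injOn hmaps hinj (hq a ha).1,
    (Set.ncard_le_ncard_of_injOn _ hmaps hinj (hq a ha).1).trans (hq a ha).2⟩
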